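/- Let (A_0, A_1) be a pair of matrices in Σ such that A_0[Δ] ∪ A_1[Δ] = Δ, the interiors of A_0[Δ] and A_1[Δ] relative to Δ are disjoint, and (A_0, A_1) is topologically contractive. If v, w ∈ {0,1}* are incomparable words (neither is a prefix of the other), then there is no index i such that both A_v e_i = e_i and A_w e_i = e_i. -/

import Mathlib

open Matrix

abbrev MatZ (n : ℕ) : Type := Matrix (Fin (n + 1)) (Fin (n + 1)) ℤ

def inSigma {n : ℕ} (A : MatZ n) : Prop :=
  IsUnit A.det ∧ ∀ i j, 0 ≤ A i j

def IsPermMat {n : ℕ} (A : MatZ n) : Prop :=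
  ∃ σ : Equiv.Perm (Fin (n + 1)), ∀ i j, A i j = if i = σ j then 1 else 0

noncomputable def toR {n : ℕ} (A : MatZ n) : Matrix (Fin (n + 1)) (Fin (n + 1)) ℝ :=
  A.map ((↑) : ℤ → ℝ)

noncomputable def projAct {n : ℕ} (A : Matrix (Fin (n + 1)) (Fin (n + 1)) ℝ)
    (x : Fin (n + 1) → ℝ) : Fin (n + 1) → ℝ :=
  (∑ i, (A *ᵥ x) i)⁻¹ • (A *ᵥ x)

noncomputable def simg {n : ℕ} (A : MatZ n) : Set (Fin (n + 1) → ℝ) :=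
  projAct (toR A) '' stdSimplex ℝ (Fin (n + 1))

def wordProd {n : ℕ} (A0 A1 : MatZ n) (w : List Bool) : MatZ n :=
  (w.map (fun b => bif b then A1 else A0)).prod

def Contractive {n : ℕ} (A0 A1 : MatZ n) : Prop :=
  ∀ a : ℕ → Bool, ∃ p,
    (⋂ t : ℕ, simg (wordProd A0 A1 ((List.range t).map a))) = {p}

def Nmat (n : ℕ) : MatZ n :=
  Matrix.of fun i j => if i = j then 1 else if j = 1 ∧ i = 0 then 1 else 0

def Fmat (n : ℕ) : MatZ n :=
  Matrix.of fun i j => if i = Equiv.swap (0 : Fin (n + 1)) 1 j then 1 else 0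

def Rmat (n : ℕ) : MatZ n :=
  Matrix.of fun i j => if i = j + 1 then 1 else 0

def Lmat (n : ℕ) : MatZ n := Fmat n * Nmat n * Fmat n

def Mon0 (n : ℕ) : MatZ n := Nmat n * Fmat n * Rmat n

def Mon1 (n : ℕ) : MatZ n := Lmat n * Rmat n

def permMat {n : ℕ} (σ : Equiv.Perm (Fin (n + 1))) : MatZ n :=
  Matrix.of fun i j => if i = σ j then 1 else 0

section helpers

variable {n : ℕ}

def rk15 (r : Fin (n+1) → ℕ) (A : MatZ n) : MatZ n :=
  Matrix.of fun a b => if r a = r b then A a b else 0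

noncomputable def Q15 (r : Fin (n+1) → ℕ) (A : MatZ n) (ε : ℝ) :
    Matrix (Fin (n+1)) (Fin (n+1)) ℝ :=
  Matrix.of fun a b => (A a b : ℝ) * ε ^ (r a - r b)

lemma Q15_zero (r : Fin (n+1) → ℕ) (A : MatZ n) (h : ∀ a b, A a b ≠ 0 → r b ≤ r a) :
    Q15 r A 0 = toR (rk15 r A) := by
  ext a b
  simp only [Q15, toR, rk15, Matrix.of_apply, Matrix.map_apply]
  by_cases hA : A a b = 0
  · simp [hA]
  · have := h a b hA
    by_cases hr : r a = r b
    · simp [hr]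
    · have : r a - r b ≠ 0 := by omega
      simp [hr, this]

lemma Q15_cont (r : Fin (n+1) → ℕ) (A : MatZ n) : Continuous (Q15 r A) := by
  unfold Q15
  refine continuous_matrix fun a b => ?_
  simp only [Matrix.of_apply]
  fun_prop

lemma Q15_rel (r : Fin (n+1) → ℕ) (A : MatZ n) (h : ∀ a b, A a b ≠ 0 → r b ≤ r a) (ε : ℝ) :
    Q15 r A ε * Matrix.diagonal (fun a => ε ^ r a) =
      Matrix.diagonal (fun a => ε ^ r a) * toR A := by
  ext a b
  rw [Matrix.mul_diagonal, Matrix.diagonal_mul]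
  simp only [Q15, toR, Matrix.of_apply, Matrix.map_apply]
  by_cases hA : A a b = 0
  · simp [hA]
  · have := h a b hA
    rw [mul_assoc, ← pow_add, Nat.sub_add_cancel this, mul_comm]

lemma toR_det (A : MatZ n) : (toR A).det = (A.det : ℝ) := by
  have := RingHom.map_det (Int.castRingHom ℝ) A
  simpa [toR] using this.symm

lemma Q15_det_ne (r : Fin (n+1) → ℕ) (A : MatZ n) (h : ∀ a b, A a b ≠ 0 → r b ≤ r a) (ε : ℝ)
    (hε : ε ≠ 0) : (Q15 r A ε).det = (A.det : ℝ) := by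
  have := congrArg Matrix.det (Q15_rel r A h ε)
  rw [Matrix.det_mul, Matrix.det_mul, mul_comm, toR_det] at this
  refine mul_left_cancel₀ ?_ this
  rw [Matrix.det_diagonal]
  exact Finset.prod_ne_zero_iff.2 fun a _ => pow_ne_zero _ hε

lemma Q15_det (r : Fin (n+1) → ℕ) (A : MatZ n) (h : ∀ a b, A a b ≠ 0 → r b ≤ r a) (ε : ℝ) :
    (Q15 r A ε).det = (A.det : ℝ) := by
  have hc : Continuous fun ε => (Q15 r A ε).det := (Q15_cont r A).matrix_det
  have := Continuous.ext_on (dense_compl_singleton (0:ℝ)) hc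
    (continuous_const (y := (A.det : ℝ))) (fun x hx => Q15_det_ne r A h x hx)
  exact congrFun this ε

lemma rk15_det (r : Fin (n+1) → ℕ) (A : MatZ n) (h : ∀ a b, A a b ≠ 0 → r b ≤ r a) :
    (rk15 r A).det = A.det := by
  have := Q15_det r A h 0
  rw [Q15_zero r A h, toR_det] at this
  exact_mod_cast this

open Filter Topology in
lemma Q15_pos (r : Fin (n+1) → ℕ) (A : MatZ n) (h : ∀ a b, A a b ≠ 0 → r b ≤ r a)
    (hu : IsUnit A.det) (hrow : ∀ a, ∑ b, rk15 r A a b = 1) :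
    ∀ᶠ ε in 𝓝[>] (0:ℝ), ∃ y : Fin (n+1) → ℝ, (∀ a, 0 < y a) ∧
      toR A *ᵥ y = fun a => (ε ^ r a)⁻¹ := by
  have hdd : (A.det : ℝ) * A.det = 1 := by
    rcases Int.isUnit_iff.1 hu with h | h <;> simp [h]
  let g : ℝ → Fin (n+1) → ℝ := fun ε => ((A.det : ℝ) • (Q15 r A ε).adjugate) *ᵥ (fun _ => 1)
  have hg : Continuous g := by
    have h1 : Continuous fun ε => (A.det : ℝ) • (Q15 r A ε).adjugate := by
      have h2 : Continuous fun ε => (Q15 r A ε).adjugate := (Q15_cont r A).matrix_adjugate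
      refine continuous_matrix fun a b => ?_
      simp only [Matrix.smul_apply, smul_eq_mul]
      exact continuous_const.mul (h2.matrix_elem a b)
    exact h1.matrix_mulVec continuous_const
  have hg0 : g 0 = fun _ => 1 := by
    have h1 : Q15 r A 0 *ᵥ (fun _ => 1) = fun _ => 1 := by
      rw [Q15_zero r A h]
      ext a
      have := congrArg (Int.cast : ℤ → ℝ) (hrow a)
      push_cast at this
      simpa [Matrix.mulVec, dotProduct, toR] using this
    show ((A.det : ℝ) • (Q15 r A 0).adjugate) *ᵥ (fun _ => 1) = _
    conv_lhs => rw [← h1]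
    rw [Matrix.mulVec_mulVec, Matrix.smul_mul, Matrix.adjugate_mul, Q15_det r A h, smul_smul, hdd,
      one_smul, Matrix.one_mulVec]
  have hev : ∀ᶠ ε in 𝓝 (0:ℝ), ∀ a, 0 < g ε a := by
    rw [eventually_all]
    intro a
    have : Tendsto (fun ε => g ε a) (𝓝 0) (𝓝 (g 0 a)) :=
      ((continuous_apply a).comp hg).tendsto 0
    rw [hg0] at this
    exact this.eventually (lt_mem_nhds one_pos)
  filter_upwards [hev.filter_mono nhdsWithin_le_nhds, self_mem_nhdsWithin] with ε hε hpos
  have hpos : 0 < ε := hpos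
  have hpw : ∀ a, ε ^ r a ≠ 0 := fun a => (pow_pos hpos _).ne'
  refine ⟨fun a => (ε ^ r a)⁻¹ * g ε a, fun a => mul_pos (inv_pos.2 (pow_pos hpos _)) (hε a), ?_⟩
  have hQ : Q15 r A ε *ᵥ g ε = fun _ => 1 := by
    show Q15 r A ε *ᵥ (((A.det : ℝ) • (Q15 r A ε).adjugate) *ᵥ (fun _ => 1)) = _
    rw [Matrix.mulVec_mulVec, Matrix.mul_smul, Matrix.mul_adjugate, Q15_det r A h, smul_smul, hdd,
      one_smul, Matrix.one_mulVec]
  ext a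
  have h2 := congrFun hQ a
  have h3 := fun b => congrFun (congrFun (Q15_rel r A h ε) a) b
  simp only [Matrix.mul_diagonal, Matrix.diagonal_mul] at h3
  simp only [Matrix.mulVec, dotProduct] at h2 ⊢
  have : ε ^ r a * ∑ b, toR A a b * ((ε ^ r b)⁻¹ * g ε b) = 1 := by
    rw [← h2, Finset.mul_sum]
    refine Finset.sum_congr rfl fun b _ => ?_
    rw [← mul_assoc, ← h3 b]
    field_simp [hpw b]
  exact eq_inv_of_mul_eq_one_right this

lemma rk15_mul (r : Fin (n+1) → ℕ) (A B : MatZ n) (h : ∀ a b, A a b ≠ 0 → r b ≤ r a)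
    (h' : ∀ a b, B a b ≠ 0 → r b ≤ r a) : rk15 r (A * B) = rk15 r A * rk15 r B := by
  ext a b
  simp only [rk15, Matrix.mul_apply, Matrix.of_apply]
  split_ifs with hr
  · refine Finset.sum_congr rfl fun c _ => ?_
    by_cases hA : A a c = 0
    · simp [hA]
    by_cases hB : B c b = 0
    · simp [hB]
    have := h _ _ hA
    have := h' _ _ hB
    rw [if_pos (by omega), if_pos (by omega)]
  · symm
    refine Finset.sum_eq_zero fun c _ => ?_
    split_ifs <;> simp
    omega

lemma rank15 (S : Submonoid (MatZ n)) (hS : ∀ M ∈ S, inSigma M)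
    (hd : ∀ M ∈ S, ∀ b, M b b ≤ 1) :
    ∃ r : Fin (n+1) → ℕ, (∀ M ∈ S, ∀ a b, M a b ≠ 0 → r b ≤ r a) ∧
      ∀ M ∈ S, ∀ a, ∑ b, rk15 r M a b = 1 := by
  classical
  let pred : Fin (n+1) → Finset (Fin (n+1)) := fun a =>
    Finset.univ.filter fun b => ∃ M ∈ S, M a b ≠ 0
  have hmulne : ∀ M ∈ S, ∀ N ∈ S, ∀ a b c, M a b ≠ 0 → N b c ≠ 0 → 
      M a b * N b c ≤ (M * N) a c := by
    intro M hM N hN a b c h1 h2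
    rw [Matrix.mul_apply]
    exact Finset.single_le_sum (f := fun j => M a j * N j c)
      (fun j _ => mul_nonneg ((hS M hM).2 _ _) ((hS N hN).2 _ _)) (Finset.mem_univ b)
  have hpos : ∀ M ∈ S, ∀ a b, M a b ≠ 0 → 1 ≤ M a b := by
    intro M hM a b h
    have := (hS M hM).2 a b
    omega
  have hsub : ∀ M ∈ S, ∀ a b, M a b ≠ 0 → pred b ⊆ pred a := by
    intro M hM a b h c hc
    simp only [pred, Finset.mem_filter, Finset.mem_univ, true_and] at hc ⊢
    obtain ⟨N, hN, hc⟩ := hc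
    refine ⟨M * N, S.mul_mem hM hN, ?_⟩
    have := hmulne M hM N hN a b c h hc
    have := hpos M hM a b h
    have := hpos N hN b c hc
    nlinarith
  let r : Fin (n+1) → ℕ := fun a => (pred a).card
  have hr : ∀ M ∈ S, ∀ a b, M a b ≠ 0 → r b ≤ r a := fun M hM a b h =>
    Finset.card_le_card (hsub M hM a b h)
  have hback : ∀ M ∈ S, ∀ a b, M a b ≠ 0 → r a = r b → ∃ N ∈ S, N b a ≠ 0 := by
    intro M hM a b h he
    have h1 := Finset.eq_of_subset_of_card_le (hsub M hM a b h) (le_of_eq he)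
    have h2 : a ∈ pred a := by
      simp only [pred, Finset.mem_filter, Finset.mem_univ, true_and]
      exact ⟨1, S.one_mem, by simp⟩
    rw [← h1] at h2
    simpa [pred] using h2
  have hnn : ∀ M ∈ S, ∀ a b, 0 ≤ rk15 r M a b := by
    intro M hM a b
    simp only [rk15, Matrix.of_apply]
    split_ifs
    · exact (hS M hM).2 _ _
    · exact le_rfl
  have hdet : ∀ M ∈ S, (rk15 r M).det ≠ 0 := by
    intro M hM
    rw [rk15_det r M (hr M hM)]
    exact (hS M hM).1.ne_zero
  have hcol1 : ∀ M ∈ S, ∀ b, ∃ a, rk15 r M a b ≠ 0 := by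
    intro M hM b
    by_contra! hc
    exact hdet M hM (Matrix.det_eq_zero_of_column_eq_zero b hc)
  have hrow1 : ∀ M ∈ S, ∀ a, ∃ b, rk15 r M a b ≠ 0 := by
    intro M hM b
    by_contra! hc
    exact hdet M hM (Matrix.det_eq_zero_of_row_eq_zero b hc)
  have hcolsum : ∀ M ∈ S, ∀ b, 1 ≤ ∑ a, rk15 r M a b := by
    intro M hM b
    obtain ⟨a, ha⟩ := hcol1 M hM b
    have h1 : rk15 r M a b ≤ ∑ a, rk15 r M a b := Finset.single_le_sum (f := fun a => rk15 r M a b)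
      (fun j _ => hnn M hM _ _) (Finset.mem_univ a)
    have h2 := hnn M hM a b
    omega
  have hrowsum : ∀ M ∈ S, ∀ a, 1 ≤ ∑ b, rk15 r M a b := by
    intro M hM a
    obtain ⟨b, ha⟩ := hrow1 M hM a
    have h1 : rk15 r M a b ≤ ∑ b, rk15 r M a b := Finset.single_le_sum (f := fun b => rk15 r M a b)
      (fun j _ => hnn M hM _ _) (Finset.mem_univ b)
    have h2 := hnn M hM a b
    omega
  have hsplit : ∀ M ∈ S, ∀ N ∈ S, ∀ b, ∑ a, rk15 r (M * N) a b =
      ∑ c, (∑ a, rk15 r M a c) * rk15 r N c b := by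
    intro M hM N hN b
    rw [rk15_mul r M N (hr M hM) (hr N hN)]
    simp only [Matrix.mul_apply, Finset.sum_mul]
    exact Finset.sum_comm
  have hret : ∀ M ∈ S, ∀ a b, rk15 r M a b ≠ 0 → ∃ N ∈ S, 1 ≤ N b a ∧ r b = r a ∧ M a b = rk15 r M a b := by
    intro M hM a b h
    simp only [rk15, Matrix.of_apply, ne_eq, ite_eq_right_iff, Classical.not_imp] at h
    obtain ⟨N, hN, hne⟩ := hback M hM a b h.2 h.1
    exact ⟨N, hN, hpos N hN _ _ hne, h.1.symm, by simp [rk15, h.1]⟩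
  have hcolle : ∀ M ∈ S, ∀ b, ∑ a, rk15 r M a b ≤ 1 := by
    intro M hM b
    by_contra! hlt
    have hgrow : ∀ K : ℕ, ∃ M' ∈ S, (K : ℤ) ≤ ∑ a, rk15 r M' a b := by
      intro K
      induction K with
      | zero => exact ⟨1, S.one_mem, by have := hcolsum 1 S.one_mem b; push_cast; omega⟩
      | succ K ih =>
        obtain ⟨M', hM', hK⟩ := ih
        obtain ⟨a, ha⟩ := hcol1 M' hM' b
        obtain ⟨N, hN, hN1, hrba, hMa⟩ := hret M' hM' a b ha
        have hNM := S.mul_mem hN hM'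
        refine ⟨M * (N * M'), S.mul_mem hM hNM, ?_⟩
        have hsum1 : (K : ℤ) ≤ ∑ c, rk15 r (N * M') c b := by
          rw [hsplit N hN M' hM']
          refine hK.trans (Finset.sum_le_sum fun c _ => ?_)
          have := hcolsum N hN c
          have := hnn M' hM' c b
          nlinarith
        have hbb : 1 ≤ rk15 r (N * M') b b := by
          simp only [rk15, Matrix.of_apply, if_true]
          have h1 := hpos M' hM' a b (by rw [hMa]; exact ha)
          have := hmulne N hN M' hM' b a b (by omega) (by omega)
          nlinarith
        rw [hsplit M hM _ hNM]
        have h1 : ∑ c, (∑ a, rk15 r M a c) * rk15 r (N * M') c b ≥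
            ∑ c, (rk15 r (N * M') c b + if c = b then 1 else 0) := by
          refine Finset.sum_le_sum fun c _ => ?_
          have h3 := hnn _ hNM c b
          split_ifs with hc
          · subst hc
            nlinarith
          · have := hcolsum M hM c
            nlinarith
        rw [Finset.sum_add_distrib] at h1
        simp only [Finset.sum_ite_eq', Finset.mem_univ, if_true] at h1
        push_cast
        linarith
    obtain ⟨M', hM', hK⟩ := hgrow (n + 2)
    obtain ⟨a, ha⟩ : ∃ a, 2 ≤ rk15 r M' a b := by
      by_contra! hc
      have : ∑ a, rk15 r M' a b ≤ ∑ a : Fin (n+1), 1 :=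
        Finset.sum_le_sum fun a _ => by have := hc a; omega
      simp at this
      push_cast at hK
      omega
    obtain ⟨N, hN, hN1, hrba, hMa⟩ := hret M' hM' a b (by omega)
    have := hmulne N hN M' hM' b a b (by omega) (by omega)
    have := hd _ (S.mul_mem hN hM') b
    nlinarith
  refine ⟨r, hr, fun M hM => ?_⟩
  have htot : ∑ a, ∑ b, rk15 r M a b ≤ ∑ a : Fin (n+1), 1 := by
    refine (le_of_eq Finset.sum_comm).trans ?_
    exact Finset.sum_le_sum fun b _ => hcolle M hM b
  intro a
  have := (Finset.sum_eq_sum_iff_of_le (s := Finset.univ) (f := fun _ : Fin (n+1) => (1:ℤ))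
    (g := fun a => ∑ b, rk15 r M a b) fun a _ => hrowsum M hM a).1
    (le_antisymm (Finset.sum_le_sum fun a _ => hrowsum M hM a) htot)
  exact (this a (Finset.mem_univ a)).symm

lemma inSigma_mul {A B : MatZ n} (hA : inSigma A) (hB : inSigma B) : inSigma (A * B) := by
  refine ⟨by rw [Matrix.det_mul]; exact hA.1.mul hB.1, fun i j => ?_⟩
  rw [Matrix.mul_apply]
  exact Finset.sum_nonneg fun k _ => mul_nonneg (hA.2 _ _) (hB.2 _ _)

lemma inSigma_one : inSigma (1 : MatZ n) := by
  refine ⟨by simp, fun i j => ?_⟩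
  rw [Matrix.one_apply]; split_ifs <;> simp

lemma wordProd_append (A0 A1 : MatZ n) (u v : List Bool) :
    wordProd A0 A1 (u ++ v) = wordProd A0 A1 u * wordProd A0 A1 v := by
  simp [wordProd]

lemma inSigma_word {A0 A1 : MatZ n} (h0 : inSigma A0) (h1 : inSigma A1) (u : List Bool) :
    inSigma (wordProd A0 A1 u) := by
  induction u with
  | nil => simpa [wordProd] using inSigma_one
  | cons b u ih =>
    have : wordProd A0 A1 (b :: u) = (bif b then A1 else A0) * wordProd A0 A1 u := by
      simp [wordProd]
    rw [this]
    refine inSigma_mul ?_ ih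
    cases b <;> simpa

lemma toR_mul (A B : MatZ n) : toR (A * B) = toR A * toR B := by
  have := Matrix.map_mul (L := A) (M := B) (f := Int.castRingHom ℝ)
  simpa [toR] using this

/- positivity facts -/
lemma mulVec_nonneg15 {A : MatZ n} (hA : inSigma A) {x : Fin (n+1) → ℝ} (hx : ∀ a, 0 ≤ x a) (a) :
    0 ≤ (toR A *ᵥ x) a := by
  simp only [Matrix.mulVec, dotProduct]
  exact Finset.sum_nonneg fun b _ => mul_nonneg (by simpa [toR] using hA.2 a b) (hx b)

lemma mulVec_pos15 {A : MatZ n} (hA : inSigma A) {x : Fin (n+1) → ℝ} (hx : ∀ a, 0 < x a) (a) :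
    0 < (toR A *ᵥ x) a := by
  obtain ⟨b, hb⟩ : ∃ b, A a b ≠ 0 := by
    by_contra! hc
    exact hA.1.ne_zero (Matrix.det_eq_zero_of_row_eq_zero a hc)
  refine Finset.sum_pos' (fun b _ => mul_nonneg (by simpa [toR] using hA.2 a b) (hx b).le)
    ⟨b, Finset.mem_univ b, mul_pos ?_ (hx b)⟩
  have := hA.2 a b
  have : 0 < A a b := by omega
  simpa [toR] using this

lemma inj15 {A : MatZ n} (hA : inSigma A) : Function.Injective fun x => toR A *ᵥ x := by
  apply Matrix.mulVec_injective_of_isUnit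
  rw [Matrix.isUnit_iff_isUnit_det, toR_det]
  exact hA.1.map (Int.castRingHom ℝ)

lemma sum_pos15 {A : MatZ n} (hA : inSigma A) {x : Fin (n+1) → ℝ} (hx : ∀ a, 0 ≤ x a)
    (hx0 : x ≠ 0) : 0 < ∑ a, (toR A *ᵥ x) a := by
  refine lt_of_le_of_ne (Finset.sum_nonneg fun a _ => mulVec_nonneg15 hA hx a) fun h => hx0 ?_
  have := (Finset.sum_eq_zero_iff_of_nonneg fun a _ => mulVec_nonneg15 hA hx a).1 h.symm
  apply inj15 hA
  ext a
  simp [this a (Finset.mem_univ a)]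

/- membership in simg in conic form -/
lemma mem_simg15 {A : MatZ n} (hA : inSigma A) (x : Fin (n+1) → ℝ) :
    x ∈ simg A ↔ (∑ a, x a = 1) ∧ ∃ y : Fin (n+1) → ℝ, (∀ a, 0 ≤ y a) ∧ toR A *ᵥ y = x := by
  constructor
  · rintro ⟨y, hy, rfl⟩
    have hy0 : y ≠ 0 := by
      rintro rfl
      simpa using hy.2
    have hp := sum_pos15 hA hy.1 hy0
    refine ⟨?_, (∑ i, (toR A *ᵥ y) i)⁻¹ • y, fun a => mul_nonneg (inv_nonneg.2 hp.le) (hy.1 a), ?_⟩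
    · simp only [projAct, Pi.smul_apply, smul_eq_mul, ← Finset.mul_sum]
      exact inv_mul_cancel₀ hp.ne'
    · rw [Matrix.mulVec_smul]; rfl
  · rintro ⟨hs, y, hy, rfl⟩
    have hy0 : y ≠ 0 := by
      rintro rfl
      simp at hs
    have hp : 0 < ∑ a, y a := by
      refine lt_of_le_of_ne (Finset.sum_nonneg fun a _ => hy a) fun h => hy0 ?_
      have := (Finset.sum_eq_zero_iff_of_nonneg fun a _ => hy a).1 h.symm
      ext a
      simp [this a (Finset.mem_univ a)]
    refine ⟨(∑ a, y a)⁻¹ • y, ⟨fun a => mul_nonneg (inv_nonneg.2 hp.le) (hy a), ?_⟩, ?_⟩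
    · simp only [Pi.smul_apply, smul_eq_mul, ← Finset.mul_sum]
      exact inv_mul_cancel₀ hp.ne'
    · simp only [projAct, Matrix.mulVec_smul, Pi.smul_apply, smul_eq_mul, ← Finset.mul_sum, hs,
        mul_one, smul_smul, inv_inv]
      rw [mul_inv_cancel₀ hp.ne', one_smul]

lemma simg_mul_subset {A B : MatZ n} (hA : inSigma A) (hB : inSigma B) :
    simg (A * B) ⊆ simg A := by
  intro x hx
  rw [mem_simg15 (inSigma_mul hA hB)] at hx
  obtain ⟨hs, y, hy, rfl⟩ := hx
  rw [mem_simg15 hA]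
  exact ⟨hs, toR B *ᵥ y, mulVec_nonneg15 hB hy, by rw [Matrix.mulVec_mulVec, toR_mul]⟩

lemma simg_compact {A : MatZ n} (hA : inSigma A) : IsCompact (simg A) := by
  refine (isCompact_stdSimplex ℝ (Fin (n+1))).image_of_continuousOn ?_
  unfold projAct
  have hc : Continuous fun x : Fin (n+1) → ℝ => toR A *ᵥ x :=
    continuous_const.matrix_mulVec continuous_id
  have hc2 : Continuous fun x : Fin (n+1) → ℝ => ∑ i, (toR A *ᵥ x) i :=
    continuous_finsetSum _ fun i _ => (continuous_apply i).comp hc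
  refine ContinuousOn.smul (ContinuousOn.inv₀ hc2.continuousOn ?_) hc.continuousOn
  · intro y hy
    refine (sum_pos15 hA hy.1 ?_).ne'
    rintro rfl
    simpa using hy.2

lemma mem_interior15 {A : MatZ n} (hA : inSigma A) (y : Fin (n+1) → ℝ) (hy : ∀ a, 0 < y a)
    (hs : ∑ a, (toR A *ᵥ y) a = 1) : toR A *ᵥ y ∈ intrinsicInterior ℝ (simg A) := by
  have hu : IsUnit (toR A).det := by
    rw [toR_det]
    exact hA.1.map (Int.castRingHom ℝ)
  have hmem : toR A *ᵥ y ∈ simg A := (mem_simg15 hA _).2 ⟨hs, y, fun a => (hy a).le, rfl⟩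
  let H : AffineSubspace ℝ (Fin (n+1) → ℝ) :=
    { carrier := {x | ∑ a, x a = 1}
      smul_vsub_vadd_mem' := by
        intro c p q s hp hq hs
        simp only [Set.mem_ofPred_eq] at *
        simp [Finset.sum_add_distrib, ← Finset.mul_sum, hp, hq, hs] }
  have hspan : affineSpan ℝ (simg A) ≤ H := by
    rw [affineSpan_le]
    intro x hx
    exact ((mem_simg15 hA x).1 hx).1
  have hc : Continuous fun x : Fin (n+1) → ℝ => (toR A)⁻¹ *ᵥ x :=
    continuous_const.matrix_mulVec continuous_id
  rw [mem_intrinsicInterior]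
  refine ⟨⟨_, subset_affineSpan ℝ _ hmem⟩, ?_, rfl⟩
  rw [mem_interior]
  refine ⟨{x | ∀ a, 0 < ((toR A)⁻¹ *ᵥ (x : Fin (n+1) → ℝ)) a}, ?_, ?_, ?_⟩
  · intro x hx
    refine (mem_simg15 hA _).2 ⟨hspan x.2, _, fun a => (hx a).le, ?_⟩
    rw [Matrix.mulVec_mulVec, Matrix.mul_nonsing_inv _ hu, Matrix.one_mulVec]
  · rw [Set.ofPred_forall]
    exact isOpen_iInter_of_finite fun a =>
      isOpen_lt continuous_const ((continuous_apply a).comp (hc.comp continuous_subtype_val))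
  · intro a
    show 0 < ((toR A)⁻¹ *ᵥ (toR A *ᵥ y)) a
    rw [Matrix.mulVec_mulVec, Matrix.nonsing_inv_mul _ hu, Matrix.one_mulVec]
    exact hy a

lemma decomp15 (v w : List Bool) (hvw : ¬ v <+: w) (hwv : ¬ w <+: v) :
    ∃ u b v' w', v = u ++ b :: v' ∧ w = u ++ (!b) :: w' := by
  induction v generalizing w with
  | nil => simp at hvw
  | cons b v ih =>
    cases w with
    | nil => simp at hwv
    | cons c w =>
      by_cases h : b = c
      · subst h
        simp only [List.cons_prefix_cons, true_and] at hvw hwv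
        obtain ⟨u, d, v', w', rfl, rfl⟩ := ih w hvw hwv
        exact ⟨b :: u, d, v', w', by simp, by simp⟩
      · refine ⟨[], b, v, w, by simp, ?_⟩
        cases b <;> cases c <;> simp_all

/- periodic sequences -/
lemma periodic15 (u : List Bool) (hu : u ≠ []) : ∃ a : ℕ → Bool, ∀ t,
    ∃ s, (List.replicate t u).flatten = (List.range t).map a ++ s := by
  have hl : 0 < u.length := List.length_pos_iff.2 hu
  have hlen : ∀ t, (List.replicate t u).flatten.length = t * u.length := by simp
  have hle : ∀ t, t ≤ t * u.length := fun t => Nat.le_mul_of_pos_right t hl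
  let a : ℕ → Bool := fun k => (List.replicate (k+1) u).flatten.getD k false
  refine ⟨a, fun t => ?_⟩
  refine ⟨(List.replicate t u).flatten.drop t, ?_⟩
  conv_lhs => rw [← List.take_append_drop t (List.replicate t u).flatten]
  congr 1
  refine List.ext_getElem (by rw [List.length_take, hlen]; simp [hle t]) fun k h1 h2 => ?_
  have hk : k < t := by simpa using h2
  simp only [List.getElem_take, List.getElem_map, List.getElem_range, a]
  have hk' : k < (List.replicate (k+1) u).flatten.length := by
    rw [hlen]; exact lt_of_lt_of_le (Nat.lt_succ_self k) (hle (k+1))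
  rw [List.getD_eq_getElem _ _ hk']
  obtain ⟨d, rfl⟩ := Nat.exists_eq_add_of_le (Nat.succ_le_of_lt hk)
  have : (List.replicate (k.succ + d) u).flatten =
      (List.replicate (k+1) u).flatten ++ (List.replicate d u).flatten := by
    rw [List.replicate_add, List.flatten_append]
  simp only [this]
  rw [List.getElem_append_left hk']

lemma wordProd_pow (A0 A1 : MatZ n) (u : List Bool) (t : ℕ) :
    wordProd A0 A1 (List.replicate t u).flatten = wordProd A0 A1 u ^ t := by
  induction t with
  | zero => simp [wordProd]
  | succ t ih =>
    rw [List.replicate_succ, List.flatten_cons, wordProd_append, ih, pow_succ']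

lemma toR_pow (A : MatZ n) (t : ℕ) : toR (A ^ t) = toR A ^ t := by
  induction t with
  | zero => simp [toR]
  | succ t ih => rw [pow_succ, pow_succ, toR_mul, ih]

lemma diag15 {A0 A1 : MatZ n} (h0 : inSigma A0) (h1 : inSigma A1) (hC : Contractive A0 A1)
    (u : List Bool) (i : Fin (n+1))
    (hi : wordProd A0 A1 u *ᵥ Pi.single i 1 = Pi.single i 1) (b : Fin (n+1)) :
    wordProd A0 A1 u b b ≤ 1 := by
  by_cases hu : u = []
  · subst hu; simp [wordProd]
  by_contra! hlt
  have hcol : ∀ a, wordProd A0 A1 u a i = (Pi.single i 1 : Fin (n+1) → ℤ) a := by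
    intro a
    rw [← hi]; simp
  have hbi : b ≠ i := by
    rintro rfl
    rw [hcol b] at hlt
    simp at hlt
  obtain ⟨a, ha⟩ := periodic15 u hu
  obtain ⟨p, hp⟩ := hC a
  set M := wordProd A0 A1 u with hM
  have hMS : inSigma M := inSigma_word h0 h1 u
  let K : ℕ → Set (Fin (n+1) → ℝ) := fun t => simg (wordProd A0 A1 ((List.range t).map a))
  have hMK : ∀ t, simg (M ^ t) ⊆ K t := by
    intro t
    obtain ⟨s, hs⟩ := ha t
    rw [← wordProd_pow, hs, wordProd_append]
    exact simg_mul_subset (inSigma_word h0 h1 _) (inSigma_word h0 h1 _)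
  have hMt : ∀ t, inSigma (M ^ t) := fun t => by
    rw [hM, ← wordProd_pow]; exact inSigma_word h0 h1 _
  have hanti : Antitone K := by
    refine antitone_nat_of_succ_le fun t => ?_
    simp only [K]
    rw [List.range_succ, List.map_append, wordProd_append]
    exact simg_mul_subset (inSigma_word h0 h1 _) (inSigma_word h0 h1 _)
  have hMe : toR M *ᵥ Pi.single i 1 = Pi.single i 1 := by
    ext c
    have := hcol c
    simp only [Matrix.mulVec_single_one, Matrix.col_apply, toR, Matrix.map_apply, this]
    by_cases hc : c = i
    · subst hc; simp
    · simp [hc]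
  have hMet : ∀ t, toR (M ^ t) *ᵥ Pi.single i 1 = Pi.single i 1 := by
    intro t
    induction t with
    | zero => rw [toR_pow, pow_zero, Matrix.one_mulVec]
    | succ t ih => rw [pow_succ, toR_mul, ← Matrix.mulVec_mulVec, hMe, ih]
  have hpi : p = Pi.single i 1 := by
    have : (Pi.single i 1 : Fin (n+1) → ℝ) ∈ ⋂ t, K t := by
      refine Set.mem_iInter.2 fun t => hMK t ?_
      refine (mem_simg15 (hMt t) _).2 ⟨by simp, Pi.single i 1, fun c => ?_, hMet t⟩
      exact (Pi.single_nonneg.2 zero_le_one : (0 : Fin (n+1) → ℝ) ≤ Pi.single i 1) c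
    rw [show (⋂ t, K t) = {p} from hp] at this
    exact this.symm
  let U : Set (Fin (n+1) → ℝ) := {x | (toR M *ᵥ x) i < 3/2 * x i ∧ x b < x i}
  have hcM : Continuous fun x : Fin (n+1) → ℝ => toR M *ᵥ x :=
    continuous_const.matrix_mulVec continuous_id
  have hU : IsOpen U := by
    have hU1 : IsOpen {x : Fin (n+1) → ℝ | (toR M *ᵥ x) i < 3/2 * x i} :=
      isOpen_lt ((continuous_apply i).comp hcM) (by fun_prop)
    have hU2 : IsOpen {x : Fin (n+1) → ℝ | x b < x i} := isOpen_lt (by fun_prop) (by fun_prop)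
    exact hU1.inter hU2
  obtain ⟨t0, ht0⟩ : ∃ t, K t ⊆ U := by
    refine exists_subset_nhds_of_isCompact (V := K) hanti.directed_ge
      (fun t => simg_compact (inSigma_word h0 h1 _)) ?_
    intro x hx
    rw [show (⋂ t, K t) = {p} from hp, hpi] at hx
    rw [Set.mem_singleton_iff] at hx
    subst hx
    refine hU.mem_nhds ⟨?_, ?_⟩
    · rw [hMe]; norm_num
    · simp [hbi]
  let x : ℕ → Fin (n+1) → ℝ := fun t => toR (M ^ t) *ᵥ Pi.single b 1
  have hxs : ∀ t, x (t+1) = toR M *ᵥ x t := by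
    intro t
    simp only [x]
    rw [pow_succ', toR_mul, Matrix.mulVec_mulVec]
  have hsb : ∀ c, 0 ≤ (Pi.single b 1 : Fin (n+1) → ℝ) c := fun c =>
    (Pi.single_nonneg.2 zero_le_one : (0 : Fin (n+1) → ℝ) ≤ Pi.single b 1) c
  have hxnn : ∀ t c, 0 ≤ x t c := fun t c => mulVec_nonneg15 (hMt t) hsb c
  have hxU : ∀ t, t0 ≤ t → x t ∈ U := by
    intro t ht
    have hsp : 0 < ∑ c, x t c := sum_pos15 (hMt t) hsb (by simp)
    have h2 : (∑ c, x t c)⁻¹ • x t ∈ U := by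
      apply ht0
      apply hanti ht
      apply hMK t
      exact ⟨Pi.single b 1, ⟨hsb, by simp⟩, rfl⟩
    have hi := inv_pos.2 hsp
    obtain ⟨h3, h4⟩ := h2
    rw [Matrix.mulVec_smul] at h3
    simp only [Pi.smul_apply, smul_eq_mul] at h3 h4
    constructor
    · refine lt_of_mul_lt_mul_left ?_ hi.le
      linarith
    · exact lt_of_mul_lt_mul_left h4 hi.le
  have hgrow : ∀ t, (2:ℝ) ^ t ≤ x t b := by
    intro t
    induction t with
    | zero => simp [x, toR]
    | succ t ih =>
      rw [hxs]
      have h5 : toR M b b * x t b ≤ (toR M *ᵥ x t) b :=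
        Finset.single_le_sum (f := fun c => toR M b c * x t c)
          (fun c _ => mul_nonneg (by simpa [toR] using hMS.2 b c) (hxnn t c)) (Finset.mem_univ b)
      have h6 : (2:ℝ) ≤ toR M b b := by
        simp only [toR, Matrix.map_apply]
        exact_mod_cast hlt
      rw [pow_succ]
      nlinarith [hxnn t b]
  have hslow : ∀ k, x (t0 + k) i ≤ (3/2) ^ k * x t0 i := by
    intro k
    induction k with
    | zero => simp
    | succ k ih =>
      rw [← add_assoc, hxs]
      have := (hxU (t0 + k) (by omega)).1
      rw [pow_succ]
      linarith
  obtain ⟨k, hk⟩ := pow_unbounded_of_one_lt (x t0 i) (show (1:ℝ) < 4/3 by norm_num)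
  have h7 := hslow k
  have h8 := (hxU (t0 + k) (by omega)).2
  have h9 := hgrow (t0 + k)
  have h10 : (2:ℝ) ^ k ≤ 2 ^ (t0 + k) := pow_le_pow_right₀ (by norm_num) (by omega)
  have h11 : (2:ℝ) ^ k = (3/2) ^ k * (4/3) ^ k := by rw [← mul_pow]; norm_num
  have h12 : (0:ℝ) < (3/2) ^ k := by positivity
  nlinarith

end helpers

theorem stmt15 (n : ℕ) (hn : 1 ≤ n) (A0 A1 : MatZ n)
    (h0 : inSigma A0) (h1 : inSigma A1)
    (hnp0 : ¬ IsPermMat A0) (hnp1 : ¬ IsPermMat A1)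
    (hcover : simg A0 ∪ simg A1 = stdSimplex ℝ (Fin (n + 1)))
    (hdisj : Disjoint (intrinsicInterior ℝ (simg A0)) (intrinsicInterior ℝ (simg A1)))
    (hC : Contractive A0 A1)
    (v w : List Bool) (hvw : ¬ v <+: w) (hwv : ¬ w <+: v) :
    ¬ ∃ i : Fin (n + 1),
      wordProd A0 A1 v *ᵥ Pi.single i 1 = Pi.single i 1 ∧
      wordProd A0 A1 w *ᵥ Pi.single i 1 = Pi.single i 1 := by
  rintro ⟨i, hv, hw⟩
  obtain ⟨u, b, v', w', rfl, rfl⟩ := decomp15 v w hvw hwv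
  set V := wordProd A0 A1 (u ++ b :: v') with hV
  set W := wordProd A0 A1 (u ++ (!b) :: w') with hW
  let S : Submonoid (MatZ n) := Submonoid.closure {V, W}
  have hS : ∀ M ∈ S, (∃ z, M = wordProd A0 A1 z) ∧
      M *ᵥ (Pi.single i 1) = Pi.single i 1 := by
    intro M hM
    induction hM using Submonoid.closure_induction with
    | mem x hx =>
      rcases hx with rfl | rfl
      · exact ⟨⟨_, hV⟩, hv⟩
      · exact ⟨⟨_, hW⟩, hw⟩
    | one => exact ⟨⟨[], by simp [wordProd]⟩, Matrix.one_mulVec _⟩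
    | mul x y _ _ hx hy =>
      obtain ⟨⟨z, hz⟩, hx⟩ := hx
      obtain ⟨⟨z', hz'⟩, hy⟩ := hy
      exact ⟨⟨z ++ z', by rw [wordProd_append, hz, hz']⟩, by
        rw [← Matrix.mulVec_mulVec, hy, hx]⟩
  have hVS : V ∈ S := Submonoid.subset_closure (by simp)
  have hWS : W ∈ S := Submonoid.subset_closure (by simp)
  obtain ⟨r, hr, hrow⟩ := rank15 S
    (fun M hM => by
      obtain ⟨⟨z, rfl⟩, _⟩ := hS M hM
      exact inSigma_word h0 h1 z)
    (fun M hM c => by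
      obtain ⟨⟨z, rfl⟩, h⟩ := hS M hM
      exact diag15 h0 h1 hC z i h c)
  have eV := Q15_pos r V (hr V hVS) (inSigma_word h0 h1 _).1 (hrow V hVS)
  have eW := Q15_pos r W (hr W hWS) (inSigma_word h0 h1 _).1 (hrow W hWS)
  obtain ⟨ε, ⟨y, hy, hy'⟩, ⟨z, hz, hz'⟩⟩ := (eV.and eW).exists
  have hcons : ∀ c s, wordProd A0 A1 (c :: s) = (bif c then A1 else A0) * wordProd A0 A1 s := by
    intro c s; simp [wordProd]
  have heq := hy'.trans hz'.symm
  rw [hV, hW, wordProd_append, wordProd_append, toR_mul, toR_mul, ← Matrix.mulVec_mulVec,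
    ← Matrix.mulVec_mulVec] at heq
  have heq2 := inj15 (inSigma_word h0 h1 u) heq
  rw [hcons, hcons, toR_mul, toR_mul, ← Matrix.mulVec_mulVec, ← Matrix.mulVec_mulVec] at heq2
  have hy1 := mulVec_pos15 (inSigma_word h0 h1 v') hy
  have hz1 := mulVec_pos15 (inSigma_word h0 h1 w') hz
  have key : ∀ p q : Fin (n+1) → ℝ, (∀ a, 0 < p a) → (∀ a, 0 < q a) →
      toR A0 *ᵥ p = toR A1 *ᵥ q → False := by
    intro p q hp hq hpq
    have hs : 0 < ∑ a, (toR A0 *ᵥ p) a :=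
      Finset.sum_pos (fun a _ => mulVec_pos15 h0 hp a) Finset.univ_nonempty
    set c := ∑ a, (toR A0 *ᵥ p) a with hc
    have hci := inv_pos.2 hs
    have e0 : ∑ a, (toR A0 *ᵥ (c⁻¹ • p)) a = 1 := by
      rw [Matrix.mulVec_smul]
      simp only [Pi.smul_apply, smul_eq_mul, ← Finset.mul_sum]
      exact inv_mul_cancel₀ hs.ne'
    have e1 : toR A0 *ᵥ (c⁻¹ • p) = toR A1 *ᵥ (c⁻¹ • q) := by
      rw [Matrix.mulVec_smul, Matrix.mulVec_smul, hpq]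
    have m0 := mem_interior15 h0 (c⁻¹ • p) (fun a => mul_pos hci (hp a)) e0
    have m1 := mem_interior15 h1 (c⁻¹ • q) (fun a => mul_pos hci (hq a)) (by rw [← e1]; exact e0)
    rw [← e1] at m1
    exact Set.disjoint_left.1 hdisj m0 m1
  cases b
  · exact key _ _ hy1 hz1 heq2
  · exact key _ _ hz1 hy1 heq2.symm
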